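/- arXiv:1201.4919 — 4 statements merged into one kernel-verified Lean document; each statement's English description precedes it below -/
import Mathlib

section
/- Let M₀ > 0, let P : ℝ → ℝ be a polynomial function with P(2·M₀) > 0, and let T > 0. Suppose f : [0,T] → ℝ is continuous, f(t) ≥ 0 for all t ∈ [0,T], and f(t) ≤ M₀ + t·P(f(t)) for all t ∈ [0,T]. Then f(t) ≤ 2·M₀ for every t ∈ [0,T] with t ≤ M₀ / P(2·M₀). -/
/-- Polynomial-type inequality (Appendix A.1.4): a continuous nonnegative
function satisfying `f t ≤ M₀ + t * P (f t)` stays bounded by `2 M₀` for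
`t ≤ M₀ / P (2 M₀)`. -/
theorem polynomial_type_inequality
    (M₀ : ℝ) (hM₀ : 0 < M₀) (P : Polynomial ℝ) (hP : 0 < P.eval (2 * M₀))
    (T : ℝ) (hT : 0 < T) (f : ℝ → ℝ)
    (hf_cont : ContinuousOn f (Set.Icc 0 T))
    (hf_nonneg : ∀ t ∈ Set.Icc (0:ℝ) T, 0 ≤ f t)
    (hf_ineq : ∀ t ∈ Set.Icc (0:ℝ) T, f t ≤ M₀ + t * P.eval (f t)) :
    ∀ t ∈ Set.Icc (0:ℝ) T, t ≤ M₀ / P.eval (2 * M₀) → f t ≤ 2 * M₀ := by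
  intro t ht htP
  by_contra! hlt
  have h₀ : f 0 ≤ 2 * M₀ := by
    have := hf_ineq 0 ⟨le_rfl, hT.le⟩
    linarith
  obtain ⟨s, hs, hfs⟩ := intermediate_value_Icc ht.1
    (hf_cont.mono (Set.Icc_subset_Icc_right ht.2)) ⟨h₀, hlt.le⟩
  have hst : s < t := lt_of_le_of_ne hs.2 (by rintro rfl; exact hlt.ne' hfs)
  have hsP : s * P.eval (2 * M₀) < M₀ := (lt_div_iff₀ hP).mp (hst.trans_le htP)
  have hineq := hf_ineq s ⟨hs.1, hs.2.trans ht.2⟩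
  rw [hfs] at hineq
  linarith
end

section
/- Let B⁺ = {x ∈ ℝ³ : ‖x‖ < 1 and x₃ > 0} and let e₃ = (0,0,1) denote the vertical unit vector in ℝ³. Let x₀ ∈ ℝ³, 0 < r₀ < 1, δ > 0, let θ₋, θ₊ : B⁺ → ℝ³ satisfy: (i) θ₋(x)·e₃ ≤ x₀·e₃ ≤ θ₊(y)·e₃ for all x, y ∈ B⁺; (ii) (θ₋(x) − x₀)·e₃ ≤ −δ and (θ₊(x) − x₀)·e₃ ≥ δ for every x ∈ B⁺ with ‖x‖ ≥ r₀. Let ψ : ℝ³ → ℝ satisfy 0 ≤ ψ ≤ 1 everywhere and ψ(x) ≥ 1/2 whenever ‖x‖ < r₀. For 0 < ε ≤ δ/3 define θ₋^ε(x) = θ₋(x) − ε·ψ(x)·e₃ and θ₊^ε(x) = θ₊(x) + ε·ψ(x)·e₃. Then |(θ₋^ε(x) − θ₊^ε(y))·e₃| ≥ ε for all x, y ∈ B⁺; in particular the images θ₋^ε(B⁺) and θ₊^ε(B⁺) are disjoint. -/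
open scoped RealInnerProductSpace

/-- The fundamental separation inequality (3.1) of the paper: the approximate
splash charts `θ₋^ε`, `θ₊^ε` have images whose vertical distance is at least
`ε`, hence disjoint images. -/
theorem splash_charts_separation
    (Bplus : Set (EuclideanSpace ℝ (Fin 3)))
    (hBplus : Bplus = {x : EuclideanSpace ℝ (Fin 3) | ‖x‖ < 1 ∧ 0 < x 2})
    (e₃ : EuclideanSpace ℝ (Fin 3)) (he₃ : e₃ = EuclideanSpace.single 2 1)
    (x₀ : EuclideanSpace ℝ (Fin 3)) (r₀ δ : ℝ) (hr₀ : 0 < r₀) (hr₀' : r₀ < 1) (hδ : 0 < δ)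
    (θm θp : EuclideanSpace ℝ (Fin 3) → EuclideanSpace ℝ (Fin 3))
    (horder : ∀ x ∈ Bplus, ∀ y ∈ Bplus, ⟪θm x, e₃⟫ ≤ ⟪x₀, e₃⟫ ∧ ⟪x₀, e₃⟫ ≤ ⟪θp y, e₃⟫)
    (hfar : ∀ x ∈ Bplus, r₀ ≤ ‖x‖ →
      ⟪θm x - x₀, e₃⟫ ≤ -δ ∧ δ ≤ ⟪θp x - x₀, e₃⟫)
    (ψ : EuclideanSpace ℝ (Fin 3) → ℝ)
    (hψ01 : ∀ x, 0 ≤ ψ x ∧ ψ x ≤ 1)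
    (hψhalf : ∀ x, ‖x‖ < r₀ → (1:ℝ)/2 ≤ ψ x)
    (ε : ℝ) (hε : 0 < ε) (hεδ : ε ≤ δ / 3)
    (θmε θpε : EuclideanSpace ℝ (Fin 3) → EuclideanSpace ℝ (Fin 3))
    (hθmε : ∀ x, θmε x = θm x - (ε * ψ x) • e₃)
    (hθpε : ∀ x, θpε x = θp x + (ε * ψ x) • e₃) :
    (∀ x ∈ Bplus, ∀ y ∈ Bplus, ε ≤ |⟪θmε x - θpε y, e₃⟫|) ∧
      Disjoint (θmε '' Bplus) (θpε '' Bplus) := by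
  have hunit : ⟪e₃, e₃⟫ = 1 := by
    rw [he₃]
    simp
  have hlow : ∀ x ∈ Bplus, ⟪θmε x, e₃⟫ ≤ ⟪x₀, e₃⟫ - ε / 2 := by
    intro x hx
    rw [hθmε, inner_sub_left, real_inner_smul_left, hunit, mul_one]
    rcases lt_or_ge ‖x‖ r₀ with h | h
    · nlinarith [hψhalf x h, (horder x hx x hx).1]
    · have hdist := (hfar x hx h).1
      rw [inner_sub_left] at hdist
      nlinarith [(hψ01 x).1]
  have hhigh : ∀ y ∈ Bplus, ⟪x₀, e₃⟫ + ε / 2 ≤ ⟪θpε y, e₃⟫ := by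
    intro y hy
    rw [hθpε, inner_add_left, real_inner_smul_left, hunit, mul_one]
    rcases lt_or_ge ‖y‖ r₀ with h | h
    · nlinarith [hψhalf y h, (horder y hy y hy).2]
    · have hdist := (hfar y hy h).2
      rw [inner_sub_left] at hdist
      nlinarith [(hψ01 y).1]
  refine ⟨fun x hx y hy => ?_, ?_⟩
  · rw [inner_sub_left, abs_sub_comm]
    exact le_trans (by linarith [hlow x hx, hhigh y hy]) (le_abs_self _)
  · rw [Set.disjoint_left]
    rintro _ ⟨x, hx, rfl⟩ ⟨y, hy, hxy⟩
    have hy' := hhigh y hy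
    rw [hxy] at hy'
    linarith [hlow x hx]
end

section
/- Let e₃ = (0,0,1) denote the vertical unit vector in ℝ³. Let T > 0, K ≥ 0, C₋, C₊ ∈ ℝ, and ε ≥ 0. Let x, y ∈ ℝ³ satisfy (y − x)·e₃ ≥ ε. Let v_x, v_y : [−T, 0] → ℝ³ be integrable functions such that ‖v_x(s) − v_x(0)‖ ≤ K·|s| and ‖v_y(s) − v_y(0)‖ ≤ K·|s| for all s ∈ [−T,0], and such that v_x(0)·e₃ ≥ C₋ and v_y(0)·e₃ ≤ −C₊. Define η_x(t) = x + ∫₀ᵗ v_x(s) ds and η_y(t) = y + ∫₀ᵗ v_y(s) ds. Then for all t ∈ [−T, 0]: ‖η_x(t) − η_y(t)‖ ≥ ε + (C₋ + C₊)·|t| − K·t². -/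
open scoped RealInnerProductSpace

/-- If the velocity `v` deviates from `v 0` by at most `K * |s|`, the displacement at a
time `t ≤ 0` deviates from `t • v 0` by at most `K * t ^ 2 / 2`. -/
theorem norm_integral_sub_smul_le_of_norm_sub_le {E : Type*} [NormedAddCommGroup E]
    [NormedSpace ℝ E] [CompleteSpace E] {v : ℝ → E} {K t : ℝ} (ht : t ≤ 0)
    (hv : IntervalIntegrable v MeasureTheory.volume t 0)
    (hdev : ∀ s ∈ Set.Icc t 0, ‖v s - v 0‖ ≤ K * |s|) :
    ‖(∫ s in (0:ℝ)..t, v s) - t • v 0‖ ≤ K * t ^ 2 / 2 := by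
  have h_eq : (∫ s in (0:ℝ)..t, v s) - t • v 0 = -∫ s in t..0, (v s - v 0) := by
    rw [← intervalIntegral.integral_symm,
      intervalIntegral.integral_sub hv.symm intervalIntegrable_const,
      intervalIntegral.integral_const, sub_zero]
  have h_bound : ‖∫ s in t..0, (v s - v 0)‖ ≤ ∫ s in t..0, K * -s := by
    refine intervalIntegral.norm_integral_le_of_norm_le ht
      (Filter.Eventually.of_forall fun s hs => ?_)
      (Continuous.intervalIntegrable (by fun_prop) _ _)
    simpa [abs_of_nonpos hs.2] using hdev s (Set.Ioc_subset_Icc_self hs)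
  rw [h_eq, norm_neg]
  refine h_bound.trans_eq ?_
  rw [intervalIntegral.integral_const_mul, intervalIntegral.integral_neg, integral_id]
  ring

/-- The key splash separation estimate (cs2)/(cs6) of Section 7: backward-in-time
trajectories of a lower particle (upward vertical velocity ≥ C₋ at time 0) and an
upper particle (downward vertical velocity ≥ C₊ at time 0), initially vertically
separated by at least ε, stay at distance at least `ε + (C₋+C₊)|t| − Kt²`. -/
theorem splash_trajectory_separation
    (e₃ : EuclideanSpace ℝ (Fin 3)) (he₃ : e₃ = EuclideanSpace.single 2 1)
    (T K Cm Cp ε : ℝ) (hT : 0 < T) (hK : 0 ≤ K) (hε : 0 ≤ ε)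
    (x y : EuclideanSpace ℝ (Fin 3)) (hxy : ε ≤ ⟪y - x, e₃⟫)
    (vx vy : ℝ → EuclideanSpace ℝ (Fin 3))
    (hvx_int : IntervalIntegrable vx MeasureTheory.volume (-T) 0)
    (hvy_int : IntervalIntegrable vy MeasureTheory.volume (-T) 0)
    (hvx_dev : ∀ s ∈ Set.Icc (-T) (0:ℝ), ‖vx s - vx 0‖ ≤ K * |s|)
    (hvy_dev : ∀ s ∈ Set.Icc (-T) (0:ℝ), ‖vy s - vy 0‖ ≤ K * |s|)
    (hvx0 : Cm ≤ ⟪vx 0, e₃⟫)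
    (hvy0 : ⟪vy 0, e₃⟫ ≤ -Cp)
    (ηx ηy : ℝ → EuclideanSpace ℝ (Fin 3))
    (hηx : ∀ t, ηx t = x + ∫ s in (0:ℝ)..t, vx s)
    (hηy : ∀ t, ηy t = y + ∫ s in (0:ℝ)..t, vy s) :
    ∀ t ∈ Set.Icc (-T) (0:ℝ),
      ε + (Cm + Cp) * |t| - K * t ^ 2 ≤ ‖ηx t - ηy t‖ := by
  intro t ht
  have he : ‖e₃‖ = 1 := by simp [he₃]
  have h_sub : Set.uIcc t 0 ⊆ Set.uIcc (-T) 0 := by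
    rw [Set.uIcc_of_le ht.2, Set.uIcc_of_le (ht.1.trans ht.2)]
    exact Set.Icc_subset_Icc_left ht.1
  have hx := norm_integral_sub_smul_le_of_norm_sub_le ht.2 (hvx_int.mono_set h_sub)
    fun s hs => hvx_dev s ⟨ht.1.trans hs.1, hs.2⟩
  have hy := norm_integral_sub_smul_le_of_norm_sub_le ht.2 (hvy_int.mono_set h_sub)
    fun s hs => hvy_dev s ⟨ht.1.trans hs.1, hs.2⟩
  have h_inner (w : EuclideanSpace ℝ (Fin 3)) : |⟪w, e₃⟫| ≤ ‖w‖ := by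
    simpa [he] using abs_real_inner_le_norm w e₃
  have hx' := (abs_le.mp ((h_inner _).trans hx)).2
  have hy' := (abs_le.mp ((h_inner _).trans hy)).1
  have h_dist := (abs_le.mp (h_inner (ηx t - ηy t))).1
  rw [hηx, hηy] at h_dist ⊢
  simp only [inner_sub_left, inner_add_left, real_inner_smul_left] at hx' hy' h_dist hxy
  rw [abs_of_nonpos ht.2]
  have hx0 := mul_le_mul_of_nonpos_left hvx0 ht.2
  have hy0 := mul_le_mul_of_nonpos_left hvy0 ht.2
  linarith
end

section
/- Let φ : ℝ³ → ℝ be Lipschitz with constant C₀ > 0. Let T > 0, K ≥ 0 and C₋, C₊ ∈ ℝ. Let γ₁, γ₂ : [−T, 0] → ℝ³ be curves such that φ∘γ₁ and φ∘γ₂ are differentiable on [−T,0], φ(γ₁(0)) ≤ 0 ≤ φ(γ₂(0)), and for all t ∈ [−T,0]: (φ∘γ₁)'(t) ≥ C₋ − K·|t| and (φ∘γ₂)'(t) ≤ −C₊ + K·|t|. Then for all t ∈ [−T, 0]: ‖γ₁(t) − γ₂(t)‖ ≥ ((C₋ + C₊)·|t| − K·t²) / C₀. -/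
/-- If, backward in time from `0`, the derivatives of `f` and `g` are bounded by `a - K|t|` from
below and by `-b + K|t|` from above, and `f 0 ≤ g 0`, then `g - f` grows at least like
`(a + b)|t| - K t ^ 2`. -/
theorem le_sub_of_hasDerivWithinAt_Icc_neg {f g f' g' : ℝ → ℝ} {T K a b : ℝ}
    (hf : ∀ t ∈ Set.Icc (-T) 0, HasDerivWithinAt f (f' t) (Set.Icc (-T) 0) t)
    (hg : ∀ t ∈ Set.Icc (-T) 0, HasDerivWithinAt g (g' t) (Set.Icc (-T) 0) t)
    (h0 : f 0 ≤ g 0)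
    (hf' : ∀ t ∈ Set.Icc (-T) 0, a - K * |t| ≤ f' t)
    (hg' : ∀ t ∈ Set.Icc (-T) 0, g' t ≤ -b + K * |t|)
    {t : ℝ} (ht : t ∈ Set.Icc (-T) 0) :
    (a + b) * |t| - K * t ^ 2 ≤ g t - f t := by
  have hderiv : ∀ s ∈ Set.Icc (-T) 0,
      HasDerivWithinAt (fun s => f s - g s - ((a + b) * s + K * s ^ 2))
        (f' s - g' s - ((a + b) + K * (2 * s))) (Set.Icc (-T) 0) s := by
    intro s hs
    have hp : HasDerivAt (fun s : ℝ => (a + b) * s + K * s ^ 2) ((a + b) + K * (2 * s)) s := by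
      refine HasDerivAt.congr_deriv
        (((hasDerivAt_id' s).const_mul (a + b)).fun_add ((hasDerivAt_pow 2 s).const_mul K)) ?_
      norm_num
    exact ((hf s hs).sub (hg s hs)).sub hp.hasDerivWithinAt
  have hmono := monotoneOn_of_hasDerivWithinAt_nonneg (convex_Icc (-T) 0)
    (fun s hs => (hderiv s hs).continuousWithinAt)
    (fun s hs => (hderiv s (interior_subset hs)).mono interior_subset)
    (fun s hs => by
      have hs' := interior_subset hs
      have h₁ := hf' s hs'
      have h₂ := hg' s hs'
      rw [abs_of_nonpos hs'.2] at h₁ h₂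
      linarith)
  have h := hmono ht ⟨ht.1.trans ht.2, le_rfl⟩ ht.2
  rw [abs_of_nonpos ht.2]
  norm_num at h
  linarith

/-- The splat separation estimate (cs1001)/(csplat2) of Section 10: for two
backward-in-time trajectories on either side of the level set `{φ = 0}` of a
`C₀`-Lipschitz function `φ`, whose compositions with `φ` have derivatives bounded
below by `C₋ − K|t|` and above by `−C₊ + K|t|` respectively, the trajectories stay
at distance at least `((C₋+C₊)|t| − Kt²)/C₀`. -/
theorem splat_trajectory_separation
    (φ : EuclideanSpace ℝ (Fin 3) → ℝ) (C₀ : ℝ) (hC₀ : 0 < C₀)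
    (hφ : LipschitzWith C₀.toNNReal φ)
    (T K Cm Cp : ℝ) (hT : 0 < T) (hK : 0 ≤ K)
    (γ₁ γ₂ : ℝ → EuclideanSpace ℝ (Fin 3))
    (d₁ d₂ : ℝ → ℝ)
    (hd₁ : ∀ t ∈ Set.Icc (-T) (0:ℝ), HasDerivAt (fun s => φ (γ₁ s)) (d₁ t) t)
    (hd₂ : ∀ t ∈ Set.Icc (-T) (0:ℝ), HasDerivAt (fun s => φ (γ₂ s)) (d₂ t) t)
    (hsign : φ (γ₁ 0) ≤ 0 ∧ 0 ≤ φ (γ₂ 0))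
    (hlow : ∀ t ∈ Set.Icc (-T) (0:ℝ), Cm - K * |t| ≤ d₁ t)
    (hup : ∀ t ∈ Set.Icc (-T) (0:ℝ), d₂ t ≤ -Cp + K * |t|) :
    ∀ t ∈ Set.Icc (-T) (0:ℝ),
      ((Cm + Cp) * |t| - K * t ^ 2) / C₀ ≤ ‖γ₁ t - γ₂ t‖ := by
  intro t ht
  have hgrowth := le_sub_of_hasDerivWithinAt_Icc_neg
    (fun s hs => (hd₁ s hs).hasDerivWithinAt) (fun s hs => (hd₂ s hs).hasDerivWithinAt)
    (hsign.1.trans hsign.2) hlow hup ht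
  have hlip := hφ.dist_le_mul (γ₁ t) (γ₂ t)
  rw [Real.coe_toNNReal _ hC₀.le, dist_eq_norm, dist_eq_norm, Real.norm_eq_abs] at hlip
  rw [div_le_iff₀' hC₀]
  linarith [neg_le_abs (φ (γ₁ t) - φ (γ₂ t))]
end
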